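/- Let f̃(·, z) : 2^V → ℝ₊ be nonnegative monotone submodular set functions on ground set V = {1,…,n} for each z, with f(S) = E_{z∼P}[f̃(S, z)], and let F and F̃(·, z) denote the multilinear extensions of f and f̃(·, z), respectively. Then for every x ∈ [0,1]ⁿ: E_z[ ‖∇F̃(x, z) − ∇F(x)‖² ] ≤ n · max_{j ∈ {1,…,n}} E_z[ f̃({j}, z)² ]. In particular, the variance constant σ of the stochastic gradients satisfies σ ≤ √n · max_{j} E_z[ f̃({j}, z)² ]^{1/2}. -/

import Mathlib

open MeasureTheory

/-- The multilinear extension of a set function on the ground set `V = {1,…,n}`. -/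
noncomputable def multilinearExt {n : ℕ} (f : Finset (Fin n) → ℝ)
    (x : EuclideanSpace ℝ (Fin n)) : ℝ :=
  ∑ S : Finset (Fin n), f S * ((∏ i ∈ S, x i) * ∏ j ∈ Sᶜ, (1 - x j))

open Finset in
/-- The probability that the random subset of `V \ {j}` containing each `i` independently with
probability `x i` equals `S`. -/
noncomputable def eraseWeight {n : ℕ} (j : Fin n) (x : EuclideanSpace ℝ (Fin n))
    (S : Finset (Fin n)) : ℝ :=
  (∏ i ∈ S, x i) * ∏ i ∈ univ.erase j \ S, (1 - x i)

open Finset in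
/-- The expected marginal gain of `j` with respect to a random subset of `V \ {j}`. -/
noncomputable def expectedMarginal {n : ℕ} (j : Fin n) (f : Finset (Fin n) → ℝ)
    (x : EuclideanSpace ℝ (Fin n)) : ℝ :=
  ∑ S ∈ (univ.erase j).powerset, eraseWeight j x S * (f (insert j S) - f S)

section Multilinear

open Finset

variable {n : ℕ} (j : Fin n) (x : EuclideanSpace ℝ (Fin n))

lemma sum_eraseWeight : ∑ S ∈ (univ.erase j).powerset, eraseWeight j x S = 1 := by
  have h := prod_add (fun i => x i) (fun i => 1 - x i) (univ.erase j)
  simpa [eraseWeight] using h.symm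

lemma eraseWeight_nonneg (hx : ∀ i, x i ∈ Set.Icc (0 : ℝ) 1) (S : Finset (Fin n)) :
    0 ≤ eraseWeight j x S :=
  mul_nonneg (prod_nonneg fun i _ => (hx i).1) (prod_nonneg fun i _ => sub_nonneg.2 (hx i).2)

lemma multilinearExt_eq_sum_erase (f : Finset (Fin n) → ℝ) :
    multilinearExt f x = ∑ S ∈ (univ.erase j).powerset,
      eraseWeight j x S * ((1 - x j) * f S + x j * f (insert j S)) := by
  have hj : j ∉ (univ : Finset (Fin n)).erase j := notMem_erase j _
  have hu : (univ : Finset (Finset (Fin n))) = (insert j (univ.erase j)).powerset := by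
    simp
  rw [multilinearExt, hu, sum_powerset_insert hj, ← sum_add_distrib]
  refine sum_congr rfl fun S hS => ?_
  have hjS : j ∉ S := fun h => hj (mem_powerset.1 hS h)
  have h1 : Sᶜ = insert j (univ.erase j \ S) := by
    ext i; by_cases h : i = j <;> simp [h, hjS]
  have h2 : (insert j S)ᶜ = univ.erase j \ S := by
    ext i; by_cases h : i = j <;> simp [h]
  rw [h1, h2, prod_insert (by simp), prod_insert hjS, eraseWeight]
  ring

lemma multilinearExt_add_single (f : Finset (Fin n) → ℝ) (t : ℝ) :
    multilinearExt f (x + t • EuclideanSpace.single j 1)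
      = multilinearExt f x + t * expectedMarginal j f x := by
  rw [multilinearExt_eq_sum_erase j, multilinearExt_eq_sum_erase j, expectedMarginal, mul_sum,
    ← sum_add_distrib]
  refine sum_congr rfl fun S hS => ?_
  have hw : eraseWeight j (x + t • EuclideanSpace.single j 1) S = eraseWeight j x S := by
    unfold eraseWeight
    congr 1 <;> refine prod_congr rfl fun i hi => ?_
    · have : i ≠ j := fun h => by
        subst h; exact notMem_erase i _ (mem_powerset.1 hS hi)
      simp [this]
    · have : i ≠ j := (mem_erase.1 (mem_sdiff.1 hi).1).1
      simp [this]
  rw [hw]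
  simp
  ring

lemma differentiable_multilinearExt (f : Finset (Fin n) → ℝ) :
    Differentiable ℝ (multilinearExt f) := by
  unfold multilinearExt
  fun_prop

lemma gradient_multilinearExt_apply (f : Finset (Fin n) → ℝ) :
    gradient (multilinearExt f) x j = expectedMarginal j f x := by
  have hd := (differentiable_multilinearExt f x).hasFDerivAt.hasLineDerivAt
    (EuclideanSpace.single j (1 : ℝ))
  have hl : HasLineDerivAt ℝ (multilinearExt f) (expectedMarginal j f x) x
      (EuclideanSpace.single j 1) := by
    unfold HasLineDerivAt
    simp only [multilinearExt_add_single]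
    simpa using ((hasDerivAt_id (0 : ℝ)).mul_const (expectedMarginal j f x)).const_add
      (multilinearExt f x)
  rw [← hd.unique hl]
  have h : inner ℝ (gradient (multilinearExt f) x) (EuclideanSpace.single j (1 : ℝ))
      = fderiv ℝ (multilinearExt f) x (EuclideanSpace.single j 1) := by
    rw [gradient, InnerProductSpace.toDual_symm_apply]
  rw [← h, EuclideanSpace.inner_single_right]
  simp

variable {x}

lemma expectedMarginal_nonneg (hx : ∀ i, x i ∈ Set.Icc (0 : ℝ) 1) {f : Finset (Fin n) → ℝ}
    (hf : ∀ A B : Finset (Fin n), A ⊆ B → f A ≤ f B) : 0 ≤ expectedMarginal j f x :=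
  sum_nonneg fun S _ => mul_nonneg (eraseWeight_nonneg j x hx S)
    (sub_nonneg.2 (hf _ _ (subset_insert j S)))

lemma expectedMarginal_le (hx : ∀ i, x i ∈ Set.Icc (0 : ℝ) 1) {f : Finset (Fin n) → ℝ}
    (hempty : 0 ≤ f ∅)
    (hf : ∀ A B : Finset (Fin n), f (A ∩ B) + f (A ∪ B) ≤ f A + f B) :
    expectedMarginal j f x ≤ f {j} := by
  calc expectedMarginal j f x
      ≤ ∑ S ∈ (univ.erase j).powerset, eraseWeight j x S * f {j} := by
        refine sum_le_sum fun S hS => mul_le_mul_of_nonneg_left ?_ (eraseWeight_nonneg j x hx S)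
        have hjS : j ∉ S := fun h => notMem_erase j _ (mem_powerset.1 hS h)
        have h := hf {j} S
        rw [singleton_inter_of_notMem hjS, singleton_union] at h
        linarith
    _ = f {j} := by rw [← sum_mul, sum_eraseWeight, one_mul]

end Multilinear

section Random

variable {n : ℕ} {Z : Type*} [MeasurableSpace Z] {P : Measure Z} {g : Finset (Fin n) → Z → ℝ}

lemma memLp_expectedMarginal {p : ENNReal} (hg : ∀ S, MemLp (g S) p P) (j : Fin n)
    (x : EuclideanSpace ℝ (Fin n)) :
    MemLp (fun z => expectedMarginal j (fun S => g S z) x) p P :=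
  memLp_finsetSum _ fun S _ => ((hg (insert j S)).sub (hg S)).const_mul (eraseWeight j x S)

lemma expectedMarginal_integral (hg : ∀ S, Integrable (g S) P) (j : Fin n)
    (x : EuclideanSpace ℝ (Fin n)) :
    expectedMarginal j (fun S => ∫ z, g S z ∂P) x
      = ∫ z, expectedMarginal j (fun S => g S z) x ∂P := by
  unfold expectedMarginal
  rw [integral_finsetSum]
  · refine Finset.sum_congr rfl fun S _ => ?_
    rw [integral_const_mul, integral_sub (hg _) (hg _)]
  · exact fun S _ => ((hg (insert j S)).sub (hg S)).const_mul _

end Random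

/-- Let `f̃(·, z)` be nonnegative monotone submodular set functions with
`f(S) = E_z[f̃(S, z)]`, and let `F`, `F̃(·, z)` be the multilinear extensions of `f`,
`f̃(·, z)`.  Then for every `x ∈ [0,1]ⁿ`,
`E_z[‖∇F̃(x, z) − ∇F(x)‖²] ≤ n·max_j E_z[f̃({j}, z)²]`; in particular the variance constant
`σ` of the stochastic gradients satisfies `σ ≤ √n·max_j E_z[f̃({j}, z)²]^(1/2)`. -/
theorem stmt11 {n : ℕ} {Z : Type} [MeasurableSpace Z]
    (P : Measure Z) [IsProbabilityMeasure P]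
    (ftil : Finset (Fin n) → Z → ℝ)
    (hmeas : ∀ S, Measurable (ftil S))
    (hint : ∀ S, Integrable (ftil S) P)
    (hint2 : ∀ S, Integrable (fun z => (ftil S z) ^ 2) P)
    (h_nonneg : ∀ z S, 0 ≤ ftil S z)
    (h_mono : ∀ z, ∀ A B : Finset (Fin n), A ⊆ B → ftil A z ≤ ftil B z)
    (h_submod : ∀ z, ∀ A B : Finset (Fin n),
      ftil (A ∩ B) z + ftil (A ∪ B) z ≤ ftil A z + ftil B z)
    (f : Finset (Fin n) → ℝ) (hf : ∀ S, f S = ∫ z, ftil S z ∂P)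
    (x : EuclideanSpace ℝ (Fin n)) (hx : ∀ j, x j ∈ Set.Icc (0 : ℝ) 1) :
    (∫ z, ‖gradient (multilinearExt (fun S => ftil S z)) x
        - gradient (multilinearExt f) x‖ ^ 2 ∂P)
      ≤ (n : ℝ) * sSup (Set.range fun j : Fin n => ∫ z, (ftil {j} z) ^ 2 ∂P) ∧
    Real.sqrt (∫ z, ‖gradient (multilinearExt (fun S => ftil S z)) x
        - gradient (multilinearExt f) x‖ ^ 2 ∂P)
      ≤ Real.sqrt n *
          Real.sqrt (sSup (Set.range fun j : Fin n => ∫ z, (ftil {j} z) ^ 2 ∂P)) := by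
  obtain rfl : f = fun S => ∫ z, ftil S z ∂P := funext hf
  have hL2 : ∀ S, MemLp (ftil S) 2 P := fun S =>
    (memLp_two_iff_integrable_sq (hmeas S).aestronglyMeasurable).2 (hint2 S)
  have hcoord : ∀ j, MemLp (fun z => expectedMarginal j (fun S => ftil S z) x) 2 P := fun j =>
    memLp_expectedMarginal hL2 j x
  have hvar : ∀ j, ∫ z, (expectedMarginal j (fun S => ftil S z) x
      - ∫ z, expectedMarginal j (fun S => ftil S z) x ∂P) ^ 2 ∂P ≤ ∫ z, (ftil {j} z) ^ 2 ∂P := by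
    intro j
    rw [← ProbabilityTheory.variance_eq_integral (hcoord j).aestronglyMeasurable.aemeasurable]
    refine (ProbabilityTheory.variance_le_expectation_sq
      (hcoord j).aestronglyMeasurable).trans ?_
    refine integral_mono (hcoord j).integrable_sq (hint2 {j}) fun z => ?_
    exact pow_le_pow_left₀ (expectedMarginal_nonneg j hx (h_mono z))
      (expectedMarginal_le j hx (h_nonneg z ∅) (h_submod z)) 2
  have hmain : (∫ z, ‖gradient (multilinearExt (fun S => ftil S z)) x
        - gradient (multilinearExt (fun S => ∫ z, ftil S z ∂P)) x‖ ^ 2 ∂P)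
      ≤ (n : ℝ) * sSup (Set.range fun j : Fin n => ∫ z, (ftil {j} z) ^ 2 ∂P) := by
    simp only [EuclideanSpace.real_norm_sq_eq, PiLp.sub_apply, gradient_multilinearExt_apply,
      expectedMarginal_integral hint]
    rw [integral_finsetSum]
    swap
    · exact fun j _ => ((hcoord j).sub (memLp_const _)).integrable_sq
    calc _ ≤ ∑ _j : Fin n, sSup (Set.range fun j : Fin n => ∫ z, (ftil {j} z) ^ 2 ∂P) :=
          Finset.sum_le_sum fun j _ => (hvar j).trans
            (le_csSup (Set.finite_range _).bddAbove (Set.mem_range_self j))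
      _ = _ := by simp
  refine ⟨hmain, ?_⟩
  rw [← Real.sqrt_mul n.cast_nonneg]
  exact Real.sqrt_le_sqrt hmain
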